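/- Let Γ be a finite graph and c ∈ C⃗₁(Γ,ℤ). Then ∂c = 0 (i.e. c ∈ H₁(Γ,ℤ)) if and only if c can be written as c = Σ_{γ ∈ Cir_{φ_c}(Γ_c)} n(γ)·[γ] for some natural-number coefficients n(γ) ∈ ℕ. -/

import Mathlib

/-!
Serre-style finite graphs: a vertex type `V`, an oriented-edge type `E` with a
fixed-point-free involution `inv` (edge reversal) and source/target maps `s, t`
with `s (inv e) = t e`.  An unoriented edge is an `inv`-orbit `{e, inv e}`;
subsets of unoriented edges are encoded as `inv`-closed subsets of `E`, and an
orientation of a spanning subgraph `Γ∖T` is encoded by the set `O` of its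
positively oriented edges.  1-chains with coefficients in `A` are encoded as
functions `c : E → A` with `c (inv e) = - c e` (so that `(c, e⃗) = c e` for the
standard bilinear form).
-/

structure SerreGraph where
  V : Type
  E : Type
  [fintypeV : Fintype V]
  [fintypeE : Fintype E]
  [decEqV : DecidableEq V]
  [decEqE : DecidableEq E]
  inv : E → E
  s : E → V
  t : E → V
  inv_inv : ∀ e, inv (inv e) = e
  inv_ne : ∀ e, inv e ≠ e
  s_inv : ∀ e, s (inv e) = t e

attribute [instance] SerreGraph.fintypeV SerreGraph.fintypeE
attribute [instance] SerreGraph.decEqV SerreGraph.decEqE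

namespace SerreGraph

variable (Γ : SerreGraph)

/-- Reachability between vertices in the spanning subgraph whose allowed oriented
edges are those in `A`. -/
def Reach (A : Set Γ.E) : Γ.V → Γ.V → Prop :=
  Relation.ReflTransGen (fun a b => ∃ e ∈ A, Γ.s e = a ∧ Γ.t e = b)

/-- The number of connected components of the spanning subgraph with allowed
oriented edges `A`. -/
noncomputable def numComponents (A : Set Γ.E) : ℕ :=
  Nat.card (Quot (fun a b : Γ.V => ∃ e ∈ A, Γ.s e = a ∧ Γ.t e = b))

/-- The set of separating (oriented) edges: removing the underlying unoriented
edge increases the number of connected components. -/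
def Esep : Set Γ.E :=
  {e | Γ.numComponents Set.univ < Γ.numComponents {f | f ≠ e ∧ f ≠ Γ.inv e}}

/-- `T` encodes a set of unoriented edges. -/
def InvClosed (T : Set Γ.E) : Prop := ∀ e, e ∈ T ↔ Γ.inv e ∈ T

/-- `O` is (the set of positively oriented edges of) an orientation of `Γ∖T`. -/
def IsOrientation (T O : Set Γ.E) : Prop :=
  (∀ e ∈ O, e ∉ T) ∧ ∀ e, e ∉ T → (e ∈ O ↔ Γ.inv e ∉ O)

/-- A totally cyclic orientation of `Γ∖T`: an orientation such that there is no
vertex set `W` which is nonempty and proper inside some connected component of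
`Γ∖T` and such that all edges of `Γ∖T` crossing the boundary of `W` are oriented
out of `W` (this is the componentwise condition of the paper). -/
def IsTotallyCyclic (T O : Set Γ.E) : Prop :=
  Γ.IsOrientation T O ∧
    ¬ ∃ W : Set Γ.V, (∃ v ∈ W, ∃ w ∈ Wᶜ, Γ.Reach Tᶜ v w) ∧
        ∀ e ∈ O, Γ.t e ∈ W → Γ.s e ∈ W

/-- `γ` is (the set of positively oriented edges of) an oriented circuit of `Γ`:
a cyclic subgraph (connected, first Betti number one, no separating edges)
together with a totally cyclic orientation; equivalently a directed cycle:
each incident vertex has exactly one outgoing and one incoming edge in `γ`,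
and the support is connected. -/
def IsCircuit (γ : Finset Γ.E) : Prop :=
  γ.Nonempty ∧ (∀ e ∈ γ, Γ.inv e ∉ γ) ∧
    (∀ v ∈ γ.image Γ.s ∪ γ.image Γ.t, ∃! e, e ∈ γ ∧ Γ.s e = v) ∧
    (∀ v ∈ γ.image Γ.s ∪ γ.image Γ.t, ∃! e, e ∈ γ ∧ Γ.t e = v) ∧
    ∀ e ∈ γ, ∀ f ∈ γ, Γ.Reach ((↑γ : Set Γ.E) ∪ Γ.inv '' ↑γ) (Γ.s e) (Γ.s f)

/-- The class `[γ] ∈ H₁(Γ,ℤ)` of an oriented circuit. -/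
def circChainZ (γ : Finset Γ.E) : Γ.E → ℤ :=
  fun e => if e ∈ γ then 1 else if Γ.inv e ∈ γ then -1 else 0

/-- The class `[γ] ∈ H₁(Γ,ℝ)` of an oriented circuit. -/
noncomputable def circChainR (γ : Finset Γ.E) : Γ.E → ℝ :=
  fun e => (Γ.circChainZ γ e : ℝ)

/-- `Cir_φ(Γ∖T)`: oriented circuits of `Γ∖T` compatibly oriented with the
orientation with positive edges `O`. -/
def Cir (T O : Set Γ.E) : Set (Finset Γ.E) :=
  {γ | Γ.IsCircuit γ ∧ (∀ e ∈ γ, e ∈ O) ∧ ∀ e ∈ γ, e ∉ T}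

/-- `c` is a 1-cycle: a skew 1-chain with vanishing boundary, i.e. an element of
`H₁(Γ,A)`. -/
def IsCycle {A : Type*} [AddCommGroup A] (c : Γ.E → A) : Prop :=
  (∀ e, c (Γ.inv e) = - c e) ∧
    ∀ v, ∑ e ∈ Finset.univ.filter (fun e => Γ.t e = v), c e = 0

/-- An element of `H₁(Γ∖T, A) ⊆ H₁(Γ,A)`: a cycle supported on edges not in `T`. -/
def IsCycleOn {A : Type*} [AddCommGroup A] (T : Set Γ.E) (c : Γ.E → A) : Prop :=
  Γ.IsCycle c ∧ ∀ e ∈ T, c e = 0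

/-- The standard positive definite bilinear form on `C⃗₁(Γ,ℝ)`, for which
`(c, e⃗) = c e`. -/
noncomputable def pair (c c' : Γ.E → ℝ) : ℝ := (∑ e, c e * c' e) / 2

/-- The first Betti number `b₁(Γ) = dim_ℝ H₁(Γ,ℝ)`. -/
noncomputable def b1 : ℕ :=
  Module.finrank ℝ (Submodule.span ℝ {c : Γ.E → ℝ | Γ.IsCycle c})

/-- `b₁(Γ∖T) = dim_ℝ H₁(Γ∖T,ℝ)`. -/
noncomputable def b1Sub (T : Set Γ.E) : ℕ :=
  Module.finrank ℝ (Submodule.span ℝ {c : Γ.E → ℝ | Γ.IsCycleOn T c})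

/-- The cone `σ(T,φ) ⊆ H₁(Γ,ℝ)` of the cographic fan associated to a pair
`(T, O)` with `O` an orientation of `Γ∖T`. -/
def sigmaCone (T O : Set Γ.E) : Set (Γ.E → ℝ) :=
  {v | Γ.IsCycle v ∧ (∀ e ∈ O, 0 ≤ v e) ∧ ∀ e ∈ T, v e = 0}

/-- The poset `OP_Γ` of totally cyclic orientations: pairs `(T, O)` with `T` a
set of unoriented edges and `O` a totally cyclic orientation of `Γ∖T`. -/
def OP : Set (Set Γ.E × Set Γ.E) :=
  {p | Γ.InvClosed p.1 ∧ Γ.IsTotallyCyclic p.1 p.2}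

/-- The order on `OP_Γ`: `(T',φ') ≤ (T,φ)` iff `T' ⊇ T` and `φ'` is the
restriction of `φ`. -/
def OPle (p q : Set Γ.E × Set Γ.E) : Prop :=
  q.1 ⊆ p.1 ∧ p.2 = q.2 ∩ p.1ᶜ

/-- `H₁(Γ,ℤ)` viewed as the set of lattice points of `H₁(Γ,ℝ)`. -/
def H1Z : Set (Γ.E → ℝ) := {c | Γ.IsCycle c ∧ ∀ e, ∃ n : ℤ, c e = (n : ℝ)}

/-- The Voronoi polytope `Vor_Γ ⊆ H₁(Γ,ℝ)`. -/
def voronoi : Set (Γ.E → ℝ) :=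
  {v | Γ.IsCycle v ∧ ∀ l ∈ Γ.H1Z, Γ.pair v v ≤ Γ.pair (v - l) (v - l)}

/-- A (exposed) face of the Voronoi polytope. -/
def IsVorFace (F : Set (Γ.E → ℝ)) : Prop :=
  ∃ l : (Γ.E → ℝ) →ₗ[ℝ] ℝ, F = {v | v ∈ Γ.voronoi ∧ ∀ w ∈ Γ.voronoi, l w ≤ l v}

/-- The face `F(T,φ)` of the Voronoi polytope associated to `(T,O) ∈ OP_Γ`. -/
def vorFace (T O : Set Γ.E) : Set (Γ.E → ℝ) :=
  {v | v ∈ Γ.voronoi ∧ ∀ γ ∈ Γ.Cir T O,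
      Γ.pair v (Γ.circChainR γ) = Γ.pair (Γ.circChainR γ) (Γ.circChainR γ) / 2}

end SerreGraph


namespace SerreGraph

variable {Γ : SerreGraph}

lemma t_inv (e : Γ.E) : Γ.t (Γ.inv e) = Γ.s e := by
  rw [← Γ.s_inv, Γ.inv_inv]

/-- Every edge of `γ` is followed by an edge of `γ`. -/
def HasSuccessors (γ : Finset Γ.E) : Prop :=
  ∀ e ∈ γ, ∃ f ∈ γ, Γ.s f = Γ.t e

lemma isCircuit_of_minimal {γ : Finset Γ.E} (hne : γ.Nonempty) (hs : Γ.HasSuccessors γ)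
    (hmin : ∀ δ ⊆ γ, δ.Nonempty → Γ.HasSuccessors δ → δ = γ)
    (hinv : ∀ e ∈ γ, Γ.inv e ∉ γ) : Γ.IsCircuit γ := by
  have s_inj : Set.InjOn Γ.s (γ : Set Γ.E) := by
    intro e he e' he' h
    by_contra hee
    have key : γ.erase e' = γ := by
      refine hmin _ (Finset.erase_subset _ _) ⟨e, Finset.mem_erase.2 ⟨hee, he⟩⟩ ?_
      intro x hx
      obtain ⟨f, hf, hfx⟩ := hs x (Finset.mem_of_mem_erase hx)
      by_cases hfe : f = e'
      · exact ⟨e, Finset.mem_erase.2 ⟨hee, he⟩, by rw [h, ← hfe, hfx]⟩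
      · exact ⟨f, Finset.mem_erase.2 ⟨hfe, hf⟩, hfx⟩
    exact Finset.erase_eq_self.1 key he'
  have pred : ∀ e ∈ γ, ∃ x ∈ γ, Γ.t x = Γ.s e := by
    have key : γ.filter (fun e => ∃ x ∈ γ, Γ.t x = Γ.s e) = γ := by
      refine hmin _ (Finset.filter_subset _ _) ?_ ?_
      · obtain ⟨e, he⟩ := hne
        obtain ⟨f, hf, hfe⟩ := hs e he
        exact ⟨f, Finset.mem_filter.2 ⟨hf, e, he, hfe.symm⟩⟩
      · intro e he
        have he' := (Finset.mem_filter.1 he).1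
        obtain ⟨f, hf, hfe⟩ := hs e he'
        exact ⟨f, Finset.mem_filter.2 ⟨hf, e, he', hfe.symm⟩, hfe⟩
    intro e he
    rw [← key] at he
    exact (Finset.mem_filter.1 he).2
  have himg : γ.image Γ.t = γ.image Γ.s := by
    ext v
    simp only [Finset.mem_image]
    constructor
    · rintro ⟨e, he, rfl⟩
      exact hs e he
    · rintro ⟨e, he, rfl⟩
      exact pred e he
  have t_inj : Set.InjOn Γ.t (γ : Set Γ.E) := by
    rw [← Finset.card_image_iff, himg, Finset.card_image_iff]
    exact s_inj
  refine ⟨hne, hinv, ?_, ?_, ?_⟩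
  · intro v hv
    rw [himg, Finset.union_self, Finset.mem_image] at hv
    obtain ⟨e, he, rfl⟩ := hv
    exact ⟨e, ⟨he, rfl⟩, fun f hf => s_inj hf.1 he hf.2⟩
  · intro v hv
    rw [← himg, Finset.union_self, Finset.mem_image] at hv
    obtain ⟨e, he, rfl⟩ := hv
    exact ⟨e, ⟨he, rfl⟩, fun f hf => t_inj hf.1 he hf.2⟩
  · intro e he f hf
    classical
    have key : γ.filter
        (fun x => Γ.Reach ((↑γ : Set Γ.E) ∪ Γ.inv '' ↑γ) (Γ.s e) (Γ.s x)) = γ := by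
      refine hmin _ (Finset.filter_subset _ _) ?_ ?_
      · exact ⟨e, Finset.mem_filter.2 ⟨he, Relation.ReflTransGen.refl⟩⟩
      · intro x hx
        obtain ⟨hx, hr⟩ := Finset.mem_filter.1 hx
        obtain ⟨y, hy, hyx⟩ := hs x hx
        exact ⟨y, Finset.mem_filter.2
          ⟨hy, Relation.ReflTransGen.tail hr ⟨x, Or.inl hx, rfl, hyx.symm⟩⟩, hyx⟩
    rw [← key] at hf
    exact (Finset.mem_filter.1 hf).2

lemma exists_isCircuit_subset {P : Finset Γ.E} (hne : P.Nonempty) (hs : Γ.HasSuccessors P)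
    (hinv : ∀ e ∈ P, Γ.inv e ∉ P) : ∃ γ ⊆ P, Γ.IsCircuit γ := by
  obtain ⟨γ, hγP, hγ⟩ := exists_minimal_le_of_wellFoundedLT
    (fun δ : Finset Γ.E => δ.Nonempty ∧ Γ.HasSuccessors δ) P ⟨hne, hs⟩
  refine ⟨γ, hγP, isCircuit_of_minimal hγ.prop.1 hγ.prop.2 ?_ ?_⟩
  · intro δ hδ h₁ h₂
    exact Finset.Subset.antisymm hδ (hγ.le_of_le ⟨h₁, h₂⟩ hδ)
  · exact fun e he h => hinv e (hγP he) (hγP h)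

lemma circChainZ_inv {γ : Finset Γ.E} (hγ : ∀ e ∈ γ, Γ.inv e ∉ γ) (e : Γ.E) :
    Γ.circChainZ γ (Γ.inv e) = - Γ.circChainZ γ e := by
  have := hγ e
  unfold circChainZ
  rw [Γ.inv_inv]
  split_ifs <;> simp_all

lemma IsCircuit.card_filter_s_eq {γ : Finset Γ.E} (hγ : Γ.IsCircuit γ) (v : Γ.V) :
    (γ.filter (fun e => Γ.s e = v)).card = (γ.filter (fun e => Γ.t e = v)).card := by
  by_cases hv : v ∈ γ.image Γ.s ∪ γ.image Γ.t
  · have one {p : Γ.E → Prop} [DecidablePred p] (h : ∃! e, e ∈ γ ∧ p e) :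
        (γ.filter p).card = 1 := by
      obtain ⟨e, he, hu⟩ := h
      refine Finset.card_eq_one.2 ⟨e, ?_⟩
      ext f
      rw [Finset.mem_filter, Finset.mem_singleton]
      exact ⟨hu f, fun h => h ▸ he⟩
    rw [one (hγ.2.2.1 v hv), one (hγ.2.2.2.1 v hv)]
  · simp only [Finset.mem_union, Finset.mem_image, not_or, not_exists, not_and] at hv
    rw [Finset.filter_false_of_mem hv.1, Finset.filter_false_of_mem hv.2]

lemma IsCircuit.isCycle_circChainZ {γ : Finset Γ.E} (hγ : Γ.IsCircuit γ) :
    Γ.IsCycle (Γ.circChainZ γ) := by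
  refine ⟨circChainZ_inv hγ.2.1, fun v => ?_⟩
  have hsplit : ∀ e, Γ.circChainZ γ e =
      (if e ∈ γ then 1 else 0) - (if Γ.inv e ∈ γ then 1 else 0) := by
    intro e
    have := hγ.2.1 e
    unfold circChainZ
    split_ifs <;> simp_all
  have hin : ∑ e ∈ Finset.univ.filter (fun e => Γ.t e = v), (if e ∈ γ then (1 : ℤ) else 0) =
      (γ.filter (fun e => Γ.t e = v)).card := by
    rw [Finset.sum_boole, Finset.filter_filter]
    congr 2
    ext e
    simp [and_comm]
  have hout : ∑ e ∈ Finset.univ.filter (fun e => Γ.t e = v),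
      (if Γ.inv e ∈ γ then (1 : ℤ) else 0) = (γ.filter (fun e => Γ.s e = v)).card := by
    rw [Finset.sum_boole, Finset.filter_filter]
    congr 1
    refine Finset.card_bij' (fun e _ => Γ.inv e) (fun e _ => Γ.inv e) ?_ ?_ ?_ ?_ <;>
      simp +contextual [Γ.inv_inv, Γ.s_inv, t_inv]
  simp_rw [hsplit]
  rw [Finset.sum_sub_distrib, hin, hout, hγ.card_filter_s_eq, sub_self]

lemma IsCycle.exists_isCircuit {c : Γ.E → ℤ} (hc : Γ.IsCycle c) (h0 : c ≠ 0) :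
    ∃ γ, Γ.IsCircuit γ ∧ ∀ e ∈ γ, 0 < c e := by
  suffices h : ∃ γ ⊆ Finset.univ.filter (fun e => 0 < c e), Γ.IsCircuit γ by
    obtain ⟨γ, hγ, hcirc⟩ := h
    exact ⟨γ, hcirc, fun e he => (Finset.mem_filter.1 (hγ he)).2⟩
  apply exists_isCircuit_subset
  · obtain ⟨e, he⟩ := Function.ne_iff.1 h0
    rcases lt_or_gt_of_ne he with h | h
    · exact ⟨Γ.inv e, by simpa [hc.1] using h⟩
    · exact ⟨e, by simpa using h⟩
  · intro e he
    have he : 0 < c e := by simpa using he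
    obtain ⟨f, hf, hneg⟩ : ∃ f ∈ Finset.univ.filter (fun f => Γ.t f = Γ.t e), c f < 0 := by
      by_contra! h
      exact he.ne' ((Finset.sum_eq_zero_iff_of_nonneg h).1 (hc.2 (Γ.t e)) e (by simp))
    refine ⟨Γ.inv f, by simpa [hc.1] using hneg, ?_⟩
    rw [Γ.s_inv]
    simpa using hf
  · intro e he
    simp only [Finset.mem_filter, Finset.mem_univ, true_and, hc.1] at he ⊢
    lia

lemma IsCycle.sub {c d : Γ.E → ℤ} (hc : Γ.IsCycle c) (hd : Γ.IsCycle d) :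
    Γ.IsCycle (c - d) := by
  refine ⟨fun e => ?_, fun v => ?_⟩
  · simp only [Pi.sub_apply, hc.1, hd.1]
    ring
  · simp only [Pi.sub_apply, Finset.sum_sub_distrib, hc.2, hd.2, sub_zero]

lemma IsCycle.exists_circuit_decomposition {c : Γ.E → ℤ} (hc : Γ.IsCycle c) :
    ∃ n : Finset Γ.E → ℕ,
      (∀ γ, n γ ≠ 0 → Γ.IsCircuit γ ∧ ∀ e ∈ γ, 0 < c e) ∧
      ∀ e, c e = ∑ γ : Finset Γ.E, (n γ : ℤ) * Γ.circChainZ γ e := by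
  induction hm : ∑ e, (c e).natAbs using Nat.strong_induction_on generalizing c with
  | _ m ih =>
    by_cases h0 : c = 0
    · exact ⟨0, by simp, by simp [h0]⟩
    obtain ⟨γ, hγ, hpos⟩ := hc.exists_isCircuit h0
    have hneg : ∀ e, Γ.inv e ∈ γ → c e < 0 := fun e he => by
      have := hpos _ he
      rw [hc.1] at this
      lia
    have hlt : ∑ e, ((c - Γ.circChainZ γ) e).natAbs < m := by
      rw [← hm]
      obtain ⟨e, he⟩ := hγ.1
      refine Finset.sum_lt_sum (fun f _ => ?_) ⟨e, Finset.mem_univ e, ?_⟩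
      · have h₁ := hpos f
        have h₂ := hneg f
        simp only [Pi.sub_apply, circChainZ]
        split_ifs <;> grind
      · have h₁ := hpos e he
        simp only [Pi.sub_apply, circChainZ, if_pos he]
        lia
    obtain ⟨n, hn, hsum⟩ := ih _ hlt (hc.sub hγ.isCycle_circChainZ) rfl
    refine ⟨n + Pi.single γ 1, fun δ hδ => ?_, fun e => ?_⟩
    · by_cases hδγ : δ = γ
      · exact hδγ ▸ ⟨hγ, hpos⟩
      · obtain ⟨h₁, h₂⟩ := hn δ (by simpa [hδγ] using hδ)
        refine ⟨h₁, fun e he => ?_⟩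
        have h₃ := h₂ e he
        have h₄ := hpos e
        have h₅ := hneg e
        simp only [Pi.sub_apply, circChainZ] at h₃
        split_ifs at h₃ <;> grind
    · have h := hsum e
      simp only [Pi.sub_apply] at h
      simp only [Pi.add_apply, Nat.cast_add, add_mul, Finset.sum_add_distrib, ← h]
      simp [Pi.single_apply]

lemma isCycle_of_circuit_decomposition {c : Γ.E → ℤ} (hc : ∀ e, c (Γ.inv e) = - c e)
    {n : Finset Γ.E → ℕ} (hn : ∀ γ, n γ ≠ 0 → Γ.IsCircuit γ)
    (hsum : ∀ e, c e = ∑ γ : Finset Γ.E, (n γ : ℤ) * Γ.circChainZ γ e) : Γ.IsCycle c := by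
  refine ⟨hc, fun v => ?_⟩
  simp_rw [hsum]
  rw [Finset.sum_comm]
  refine Finset.sum_eq_zero fun γ _ => ?_
  rw [← Finset.mul_sum]
  by_cases h : n γ = 0
  · simp [h]
  · rw [(hn γ h).isCycle_circChainZ.2 v, mul_zero]

end SerreGraph

/-- A skew integral 1-chain `c` is a cycle (`∂c = 0`) if and
only if it is an `ℕ`-linear combination of classes of oriented circuits
compatibly oriented with, and supported on, `c`. -/
theorem stmt2 (Γ : SerreGraph) (c : Γ.E → ℤ) (hc : ∀ e, c (Γ.inv e) = - c e) :
    Γ.IsCycle c ↔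
      ∃ n : Finset Γ.E → ℕ,
        (∀ γ, n γ ≠ 0 → Γ.IsCircuit γ ∧ ∀ e ∈ γ, 0 < c e) ∧
        ∀ e, c e = ∑ γ : Finset Γ.E, (n γ : ℤ) * Γ.circChainZ γ e := by
  refine ⟨fun h => h.exists_circuit_decomposition, ?_⟩
  rintro ⟨n, hn, hsum⟩
  exact SerreGraph.isCycle_of_circuit_decomposition hc (fun γ h => (hn γ h).1) hsum
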